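/- There exist constants θ ∈ (0,1) and c > 0 depending only on the dimension n such that the following holds. Let u be a smooth positive solution of the heat equation on Q_{R,T} := B(x₀,R) × [t₀ − T, t₀] ⊂ ℝⁿ × ℝ with u ≤ M on Q_{R,T}. Then for all x, y ∈ B(x₀, R/2) with |x − y| ≤ min(√T, R) and all t ∈ [t₀ − T/2, t₀], one has M/u(y,t) ≥ c (M/u(x,t))^θ. (Euclidean case of the elliptic-type Harnack inequality of Remark 2.1, obtained by integrating estimate (1.4) along a geodesic.) -/

import Mathlib

open Metric Set

/-- Spatial gradient of a function on Euclidean space. -/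
noncomputable def sgrad {n : ℕ} (f : EuclideanSpace ℝ (Fin n) → ℝ)
    (x : EuclideanSpace ℝ (Fin n)) : EuclideanSpace ℝ (Fin n) :=
  gradient f x

/-- Spatial Laplacian: sum of the second partial derivatives. -/
noncomputable def slap {n : ℕ} (f : EuclideanSpace ℝ (Fin n) → ℝ)
    (x : EuclideanSpace ℝ (Fin n)) : ℝ :=
  ∑ i : Fin n, fderiv ℝ (fun y => fderiv ℝ f y (EuclideanSpace.single i 1)) x
    (EuclideanSpace.single i 1)

/-- `u(x,t)` is a (smooth) solution of the heat equation on `Q`. -/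
def IsHeatSolutionOn {n : ℕ} (u : EuclideanSpace ℝ (Fin n) → ℝ → ℝ)
    (Q : Set (EuclideanSpace ℝ (Fin n) × ℝ)) : Prop :=
  ContDiffOn ℝ (⊤ : ℕ∞) (fun p : EuclideanSpace ℝ (Fin n) × ℝ => u p.1 p.2) Q ∧
  ∀ p ∈ Q, deriv (fun s => u p.1 s) p.2 = slap (fun y => u y p.2) p.1


section Calculus

open Filter Topology

variable {X : Type*} [NormedAddCommGroup X] [NormedSpace ℝ X]

lemma hasDerivAt_comp_line {f : X → ℝ} {p a : X} {l : ℝ}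
    (h : DifferentiableAt ℝ f (p + l • a)) :
    HasDerivAt (fun s : ℝ => f (p + s • a)) (fderiv ℝ f (p + l • a) a) l := by
  have h1 : HasDerivAt (fun s : ℝ => p + s • a) a l := by
    simpa using ((hasDerivAt_id l).smul_const a).const_add p
  exact h.hasFDerivAt.comp_hasDerivAt l h1

lemma ContDiffOn.fderiv_apply_const {f : X → ℝ} {O : Set X}
    (hf : ContDiffOn ℝ (⊤ : ℕ∞) f O) (hO : IsOpen O) (a : X) :
    ContDiffOn ℝ (⊤ : ℕ∞) (fun p => fderiv ℝ f p a) O :=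
  (hf.fderiv_of_isOpen hO (by simp)).clm_apply contDiffOn_const

lemma ContDiffOn.differentiableAt_of_isOpen {f : X → ℝ} {O : Set X}
    (hf : ContDiffOn ℝ (⊤ : ℕ∞) f O) (hO : IsOpen O) {p : X} (hp : p ∈ O) :
    DifferentiableAt ℝ f p :=
  (hf.contDiffAt (hO.mem_nhds hp)).differentiableAt (by simp)

lemma fderiv_fderiv_apply_comm {f : X → ℝ} {O : Set X}
    (hf : ContDiffOn ℝ (⊤ : ℕ∞) f O) (hO : IsOpen O) {p : X} (hp : p ∈ O) (a b : X) :
    fderiv ℝ (fun q => fderiv ℝ f q a) p b = fderiv ℝ (fun q => fderiv ℝ f q b) p a := by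
  have hd : DifferentiableAt ℝ (fderiv ℝ f) p :=
    ((hf.fderiv_of_isOpen (m := (⊤ : ℕ∞)) hO (by simp)).contDiffAt
      (hO.mem_nhds hp)).differentiableAt (by simp)
  have hs : IsSymmSndFDerivAt ℝ f p :=
    (hf.contDiffAt (hO.mem_nhds hp)).isSymmSndFDerivAt
      (by simpa using WithTop.coe_le_coe.2 (le_top : (2 : ℕ∞) ≤ ⊤))
  have key : ∀ c d : X, fderiv ℝ (fun q => fderiv ℝ f q c) p d = fderiv ℝ (fderiv ℝ f) p d c := by
    intro c d
    rw [fderiv_clm_apply hd (differentiableAt_const c)]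
    simp
  rw [key, key]
  exact hs.eq b a

lemma IsLocalMax.second_deriv_nonpos {f f' : ℝ → ℝ} {a f'' : ℝ} (hmax : IsLocalMax f a)
    (hf : ∀ᶠ s in 𝓝 a, HasDerivAt f (f' s) s) (hf' : HasDerivAt f' f'' a) : f'' ≤ 0 := by
  by_contra! hpos
  have hd : deriv f =ᶠ[𝓝 a] f' := hf.mono fun s hs => hs.deriv
  have h2 : deriv (deriv f) a = f'' := by rw [hd.deriv_eq, hf'.deriv]
  have hmin : IsLocalMin f a :=
    isLocalMin_of_deriv_deriv_pos (by rw [h2]; exact hpos) hmax.deriv_eq_zero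
      hf.self_of_nhds.continuousAt
  have hc : f =ᶠ[𝓝 a] fun _ => f a := by
    filter_upwards [hmax, hmin] with s h1 h2 using le_antisymm h1 h2
  have : deriv (deriv f) a = 0 := by
    have h3 : deriv f =ᶠ[𝓝 a] fun _ => 0 := by
      filter_upwards [hc.eventuallyEq_nhds] with s hs
      rw [hs.deriv_eq]; simp
    rw [h3.deriv_eq]; simp
  linarith

lemma HasDerivAt.nonneg_of_eventually_le_left {f : ℝ → ℝ} {a f' : ℝ} (hf : HasDerivAt f f' a)
    (h : ∀ᶠ s in 𝓝[<] a, f s ≤ f a) : 0 ≤ f' := by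
  have hs := hf.hasDerivWithinAt (s := Iio a)
  rw [hasDerivWithinAt_iff_tendsto_slope' (by simp)] at hs
  refine ge_of_tendsto hs ?_
  filter_upwards [h, self_mem_nhdsWithin] with s h1 (h2 : s < a)
  rw [slope_def_field]
  exact div_nonneg_of_nonpos (by linarith) (by linarith)

lemma HasDerivAt.mul_const_sub_log {u : ℝ → ℝ} {u' s : ℝ} (k : ℝ) (hu : HasDerivAt u u' s)
    (hpos : 0 < u s) :
    HasDerivAt (fun s => u s * (k - Real.log (u s))) ((k - 1 - Real.log (u s)) * u') s := by
  refine (hu.mul ((hu.log hpos.ne').const_sub k)).congr_deriv ?_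
  field_simp
  ring

/-- First and second order conditions along a line for the comparison function
`ψ v - m u (k - log u)`. -/
lemma comparison_conditions_of_isLocalMax {ψ ψ' v v' u u' : ℝ → ℝ} {ψ'' v'' u'' m k a : ℝ}
    (hψ : ∀ᶠ s in 𝓝 a, HasDerivAt ψ (ψ' s) s) (hψ' : HasDerivAt ψ' ψ'' a)
    (hv : ∀ᶠ s in 𝓝 a, HasDerivAt v (v' s) s) (hv' : HasDerivAt v' v'' a)
    (hu : ∀ᶠ s in 𝓝 a, HasDerivAt u (u' s) s) (hu' : HasDerivAt u' u'' a)
    (hpos : ∀ᶠ s in 𝓝 a, 0 < u s)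
    (hmax : IsLocalMax (fun s => ψ s * v s - m * (u s * (k - Real.log (u s)))) a) :
    ψ' a * v a + ψ a * v' a = m * ((k - 1 - Real.log (u a)) * u' a) ∧
    ψ'' * v a + 2 * (ψ' a * v' a) + ψ a * v''
      - m * ((k - 1 - Real.log (u a)) * u'' - u' a ^ 2 / u a) ≤ 0 := by
  have h1 : ∀ᶠ s in 𝓝 a, HasDerivAt (fun s => ψ s * v s - m * (u s * (k - Real.log (u s))))
      (ψ' s * v s + ψ s * v' s - m * ((k - 1 - Real.log (u s)) * u' s)) s := by
    filter_upwards [hψ, hv, hu, hpos] with s a1 a2 a3 a4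
    exact (a1.mul a2).sub ((a3.mul_const_sub_log k a4).const_mul m)
  have hpa := hpos.self_of_nhds
  have hψa := hψ.self_of_nhds
  have hva := hv.self_of_nhds
  have hua := hu.self_of_nhds
  have h2 := ((hψ'.mul hva).add (hψa.mul hv')).sub
    ((((hua.log hpa.ne').const_sub (k - 1)).mul hu').const_mul m)
  have h3 := hmax.hasDerivAt_eq_zero h1.self_of_nhds
  refine ⟨by linarith, ?_⟩
  have h4 := hmax.second_deriv_nonpos h1 h2
  refine le_of_eq_of_le ?_ h4
  field_simp
  ring

end Calculus

section Heat
open Filter Topology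
variable {n : ℕ}

/-- The heat equation on a subset of space-time, in terms of the total derivative. -/
def JointHeatOn (U : EuclideanSpace ℝ (Fin n) × ℝ → ℝ)
    (O : Set (EuclideanSpace ℝ (Fin n) × ℝ)) : Prop :=
  ∀ p ∈ O, fderiv ℝ U p (0, 1) =
    ∑ i, fderiv ℝ (fun q => fderiv ℝ U q (EuclideanSpace.single i 1, 0)) p
      (EuclideanSpace.single i 1, 0)

lemma fderiv_slice {f : EuclideanSpace ℝ (Fin n) × ℝ → ℝ} {x : EuclideanSpace ℝ (Fin n)} {t : ℝ}
    (h : DifferentiableAt ℝ f (x, t)) (a : EuclideanSpace ℝ (Fin n)) :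
    fderiv ℝ (fun y => f (y, t)) x a = fderiv ℝ f (x, t) (a, 0) := by
  have h1 : HasFDerivAt (fun y : EuclideanSpace ℝ (Fin n) => (y, t))
      (ContinuousLinearMap.inl ℝ (EuclideanSpace ℝ (Fin n)) ℝ) x := hasFDerivAt_prodMk_left x t
  have h2 := h.hasFDerivAt.comp x h1
  have h3 : HasFDerivAt (fun y => f (y, t)) _ x := h2
  rw [h3.fderiv]
  simp

lemma jointHeatOn_of_deriv_eq_slap {U : EuclideanSpace ℝ (Fin n) × ℝ → ℝ}
    {O : Set (EuclideanSpace ℝ (Fin n) × ℝ)} (hO : IsOpen O)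
    (hU : ContDiffOn ℝ (⊤ : ℕ∞) U O)
    (h : ∀ p ∈ O, deriv (fun s => U (p.1, s)) p.2 = slap (fun y => U (y, p.2)) p.1) :
    JointHeatOn U O := by
  rintro ⟨x, t⟩ hp
  have h1 := h _ hp
  have ht : deriv (fun s => U (x, s)) t = fderiv ℝ U (x, t) (0, 1) := by
    have h2 : HasDerivAt (fun s : ℝ => (x, s)) ((0 : EuclideanSpace ℝ (Fin n)), (1 : ℝ)) t :=
      (hasDerivAt_const t x).prodMk (hasDerivAt_id t)
    exact ((hU.differentiableAt_of_isOpen hO hp).hasFDerivAt.comp_hasDerivAt t h2).deriv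
  rw [← ht, h1]
  refine Finset.sum_congr rfl fun i _ => ?_
  have hev : ∀ᶠ y in 𝓝 x, (y, t) ∈ O :=
    (Continuous.prodMk_left t).continuousAt.eventually (hO.mem_nhds hp)
  have h3 : (fun y => fderiv ℝ (fun y => U (y, t)) y (EuclideanSpace.single i 1)) =ᶠ[𝓝 x]
      fun y => fderiv ℝ U (y, t) (EuclideanSpace.single i 1, 0) := by
    filter_upwards [hev] with y hy
    exact fderiv_slice (hU.differentiableAt_of_isOpen hO hy) _
  rw [h3.fderiv_eq]
  exact fderiv_slice
    ((hU.fderiv_apply_const hO (EuclideanSpace.single i 1, 0)).differentiableAt_of_isOpen hO hp) _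

lemma JointHeatOn.fderiv_apply {U : EuclideanSpace ℝ (Fin n) × ℝ → ℝ}
    {O : Set (EuclideanSpace ℝ (Fin n) × ℝ)} (h : JointHeatOn U O) (hO : IsOpen O)
    (hU : ContDiffOn ℝ (⊤ : ℕ∞) U O) (a : EuclideanSpace ℝ (Fin n) × ℝ) :
    JointHeatOn (fun q => fderiv ℝ U q a) O := by
  intro p hp
  have h1 : (fun q => fderiv ℝ U q (0, 1)) =ᶠ[𝓝 p] fun q =>
      ∑ i, fderiv ℝ (fun q => fderiv ℝ U q (EuclideanSpace.single i 1, 0)) q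
        (EuclideanSpace.single i 1, 0) := by
    filter_upwards [hO.mem_nhds hp] with q hq using h q hq
  have hi := fun i : Fin n => hU.fderiv_apply_const hO (EuclideanSpace.single i 1, 0)
  rw [fderiv_fderiv_apply_comm hU hO hp, h1.fderiv_eq, fderiv_fun_sum fun i _ =>
    ((hi i).fderiv_apply_const hO _).differentiableAt_of_isOpen hO hp]
  simp only [_root_.sum_apply]
  refine Finset.sum_congr rfl fun i _ => ?_
  rw [fderiv_fderiv_apply_comm (hi i) hO hp]
  have h2 : (fun q => fderiv ℝ (fun q => fderiv ℝ U q (EuclideanSpace.single i 1, 0)) q a)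
      =ᶠ[𝓝 p] fun q => fderiv ℝ (fun q => fderiv ℝ U q a) q (EuclideanSpace.single i 1, 0) := by
    filter_upwards [hO.mem_nhds hp] with q hq using fderiv_fderiv_apply_comm hU hO hq _ _
  rw [h2.fderiv_eq]


/-- Algebraic consequence of the first and second order conditions at a maximum. -/
lemma sq_le_of_maximum_conditions {ι : Type*} [Fintype ι] {ψ v m u ℓ D A B C : ℝ}
    {dψ du dv : ι → ℝ} (hψ : 0 < ψ) (hm : 0 < m) (hu : 0 < u) (hℓ : 1 ≤ ℓ)
    (hA : 0 ≤ A) (hC : 0 ≤ C) (heq : ψ * v = m * (u * ℓ))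
    (hgrad : ∀ i, dψ i * v + ψ * dv i = m * ((ℓ - 1) * du i))
    (hheat : 0 ≤ D * v - 2 * ∑ i, dψ i * dv i - m * ((∑ i, du i ^ 2) / u))
    (hD : ψ * D ≤ A) (hB : ∑ i, dψ i ^ 2 ≤ B) (hv : v ^ 2 ≤ C * ∑ i, du i ^ 2) :
    m ^ 2 ≤ 2 * C * (A + 4 * B) := by
  set S := ∑ i, du i ^ 2 with hS
  have hcross : -(2 * ψ ^ 2 * ∑ i, dψ i * dv i) ≤
      2 * (m * (u * ℓ)) * ∑ i, dψ i ^ 2 + m * (ψ ^ 2 * S / (2 * u) +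
        2 * u * ℓ ^ 2 * ∑ i, dψ i ^ 2) := by
    rw [hS, Finset.mul_sum, Finset.mul_sum, Finset.mul_sum, Finset.sum_div, Finset.mul_sum,
      ← Finset.sum_add_distrib, Finset.mul_sum, ← Finset.sum_add_distrib, ← Finset.sum_neg_distrib]
    refine Finset.sum_le_sum fun i _ => ?_
    have h1 : ψ ^ 2 * (dψ i * dv i) =
        m * (ℓ - 1) * ψ * (dψ i * du i) - m * (u * ℓ) * dψ i ^ 2 := by
      have : ψ * dv i = m * ((ℓ - 1) * du i) - dψ i * v := by linarith [hgrad i]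
      calc ψ ^ 2 * (dψ i * dv i) = ψ * dψ i * (ψ * dv i) := by ring
        _ = m * (ℓ - 1) * ψ * (dψ i * du i) - (ψ * v) * dψ i ^ 2 := by rw [this]; ring
        _ = _ := by rw [heq]
    have h2 : -(2 * (ℓ - 1) * ψ * (dψ i * du i)) ≤
        ψ ^ 2 * du i ^ 2 / (2 * u) + 2 * u * ℓ ^ 2 * dψ i ^ 2 := by
      have h3 : 0 ≤ (ψ * du i + 2 * u * (ℓ - 1) * dψ i) ^ 2 / (2 * u) := by positivity
      have h4 : (ψ * du i + 2 * u * (ℓ - 1) * dψ i) ^ 2 / (2 * u) =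
          ψ ^ 2 * du i ^ 2 / (2 * u) + 2 * (ℓ - 1) * ψ * (dψ i * du i)
            + 2 * u * (ℓ - 1) ^ 2 * dψ i ^ 2 := by
        field_simp; ring
      have h5 : 2 * u * (ℓ - 1) ^ 2 * dψ i ^ 2 ≤ 2 * u * ℓ ^ 2 * dψ i ^ 2 := by
        have : (ℓ - 1) ^ 2 ≤ ℓ ^ 2 := by nlinarith
        gcongr
      linarith
    nlinarith [mul_le_mul_of_nonneg_left h2 hm.le]
  have hmain : 0 ≤ m * (u * ℓ) * (ψ * D) - 2 * ψ ^ 2 * ∑ i, dψ i * dv i - m * (ψ ^ 2 * S / u) := by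
    have := mul_nonneg (sq_nonneg ψ) hheat
    have e : ψ ^ 2 * (D * v - 2 * ∑ i, dψ i * dv i - m * (S / u)) =
        (ψ * v) * (ψ * D) - 2 * ψ ^ 2 * ∑ i, dψ i * dv i - m * (ψ ^ 2 * S / u) := by ring
    rwa [e, heq] at this
  have hB0 : 0 ≤ ∑ i, dψ i ^ 2 := Finset.sum_nonneg fun i _ => sq_nonneg _
  have hS0 : 0 ≤ S := Finset.sum_nonneg fun i _ => sq_nonneg _
  have hhalf : ψ ^ 2 * S / (2 * u) ≤ u * ℓ ^ 2 * (A + 4 * B) := by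
    have h1 : 0 ≤ m * (u * ℓ * (ψ * D) + 2 * (u * ℓ) * ∑ i, dψ i ^ 2
        + 2 * u * ℓ ^ 2 * ∑ i, dψ i ^ 2 - ψ ^ 2 * S / (2 * u)) := by
      have e : ψ ^ 2 * S / u = 2 * (ψ ^ 2 * S / (2 * u)) := by field_simp
      rw [e] at hmain
      linarith
    have h2 := nonneg_of_mul_nonneg_right h1 hm
    have hℓ2 : ℓ ≤ ℓ ^ 2 := by nlinarith
    have h3 : u * ℓ * (ψ * D) ≤ u * ℓ ^ 2 * A := by
      calc u * ℓ * (ψ * D) ≤ u * ℓ * A := by gcongr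
        _ ≤ _ := by gcongr
    have h4 : 2 * (u * ℓ) * ∑ i, dψ i ^ 2 ≤ 2 * (u * ℓ ^ 2) * B := by gcongr
    have h5 : 2 * u * ℓ ^ 2 * ∑ i, dψ i ^ 2 ≤ 2 * u * ℓ ^ 2 * B := by gcongr
    linarith
  have hψS : ψ ^ 2 * S ≤ 2 * (u * ℓ) ^ 2 * (A + 4 * B) := by
    rw [div_le_iff₀ (by positivity)] at hhalf
    linarith
  have hul : 0 < (u * ℓ) ^ 2 := by positivity
  refine le_of_mul_le_mul_right ?_ hul
  calc m ^ 2 * (u * ℓ) ^ 2 = ψ ^ 2 * v ^ 2 := by rw [← mul_pow, ← heq, mul_pow]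
    _ ≤ ψ ^ 2 * (C * S) := by gcongr
    _ = C * (ψ ^ 2 * S) := by ring
    _ ≤ C * (2 * (u * ℓ) ^ 2 * (A + 4 * B)) := by gcongr
    _ = _ := by ring

lemma fderiv_apply_sq_le {U : EuclideanSpace ℝ (Fin n) × ℝ → ℝ}
    {p : EuclideanSpace ℝ (Fin n) × ℝ} (e : EuclideanSpace ℝ (Fin n)) :
    fderiv ℝ U p (e, 0) ^ 2 ≤
      ‖e‖ ^ 2 * ∑ i, fderiv ℝ U p (EuclideanSpace.single i 1, 0) ^ 2 := by
  have h : fderiv ℝ U p (e, 0) =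
      ∑ i, e i * fderiv ℝ U p (EuclideanSpace.single i 1, 0) := by
    have he : ((e, 0) : EuclideanSpace ℝ (Fin n) × ℝ) =
        ∑ i, e i • ((EuclideanSpace.single i 1, 0) : EuclideanSpace ℝ (Fin n) × ℝ) := by
      refine Prod.ext ?_ ?_
      · rw [Prod.fst_sum]
        ext j
        simp [Finset.sum_apply, Pi.single_apply]
      · simp [Prod.snd_sum]
    conv_lhs => rw [he]
    simp only [map_sum, map_smul, smul_eq_mul]
  rw [h, EuclideanSpace.real_norm_sq_eq]
  exact Finset.sum_mul_sq_le_sq_mul_sq _ _ _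

/-- Cutoff function of the parabolic cylinder with top centre `(z, t)` and radius `r`. -/
noncomputable def parabolicCutoff (z : EuclideanSpace ℝ (Fin n)) (t r : ℝ)
    (q : EuclideanSpace ℝ (Fin n) × ℝ) : ℝ :=
  (r ^ 2 - ‖q.1 - z‖ ^ 2) * (q.2 - (t - r ^ 2))

lemma parabolicCutoff_add_space (z : EuclideanSpace ℝ (Fin n)) (t r : ℝ)
    (p : EuclideanSpace ℝ (Fin n) × ℝ) (i : Fin n) (s : ℝ) :
    parabolicCutoff z t r (p + s • (EuclideanSpace.single i 1, 0)) =
      (r ^ 2 - ‖p.1 - z‖ ^ 2 - 2 * s * (p.1 - z) i - s ^ 2) * (p.2 - (t - r ^ 2)) := by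
  have h : (p + s • ((EuclideanSpace.single i 1, 0) : EuclideanSpace ℝ (Fin n) × ℝ)).1 - z =
      (p.1 - z) + s • EuclideanSpace.single i (1 : ℝ) := by simp; abel
  rw [parabolicCutoff, h, norm_add_sq_real, norm_smul, real_inner_smul_right,
    EuclideanSpace.inner_single_right]
  simp
  left
  ring

lemma parabolicCutoff_add_time (z : EuclideanSpace ℝ (Fin n)) (t r : ℝ)
    (p : EuclideanSpace ℝ (Fin n) × ℝ) (s : ℝ) :
    parabolicCutoff z t r (p + s • (0, 1)) =
      (r ^ 2 - ‖p.1 - z‖ ^ 2) * (p.2 + s - (t - r ^ 2)) := by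
  simp [parabolicCutoff]

/-- Estimate at a positive interior maximum of `ψ v / (u (1 + log (M / u)))`, with `ψ` the parabolic
cutoff and `v` a spatial derivative of `u`. -/
lemma sq_le_of_cutoff_maximum {U : EuclideanSpace ℝ (Fin n) × ℝ → ℝ}
    {O : Set (EuclideanSpace ℝ (Fin n) × ℝ)} (hO : IsOpen O)
    (hU : ContDiffOn ℝ (⊤ : ℕ∞) U O) (hheat : JointHeatOn U O) {k : ℝ}
    (hpos : ∀ p ∈ O, 0 < U p) (hle : ∀ p ∈ O, Real.log (U p) + 1 ≤ k)
    {z : EuclideanSpace ℝ (Fin n)} {t r m : ℝ} (e : EuclideanSpace ℝ (Fin n))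
    {p : EuclideanSpace ℝ (Fin n) × ℝ} (hpO : p ∈ O) (hm : 0 < m)
    (hpz : ‖p.1 - z‖ < r) (hpt : t - r ^ 2 < p.2) (hpt' : p.2 ≤ t)
    (heq : parabolicCutoff z t r p * fderiv ℝ U p (e, 0) = m * (U p * (k - Real.log (U p))))
    (hmax : ∀ q ∈ closedBall z r ×ˢ Icc (t - r ^ 2) t,
      parabolicCutoff z t r q * fderiv ℝ U q (e, 0) ≤ m * (U q * (k - Real.log (U q)))) :
    m ^ 2 ≤ 2 * ‖e‖ ^ 2 * ((2 * n + 17) * r ^ 6) := by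
  have hr : 0 < r := (norm_nonneg _).trans_lt hpz
  set v : EuclideanSpace ℝ (Fin n) × ℝ → ℝ := fun q => fderiv ℝ U q (e, 0) with hvdef
  have hv : ContDiffOn ℝ (⊤ : ℕ∞) v O := hU.fderiv_apply_const hO _
  have hvheat : JointHeatOn v O := hheat.fderiv_apply hO hU _
  set τ := p.2 - (t - r ^ 2) with hτ
  set ρ := r ^ 2 - ‖p.1 - z‖ ^ 2 with hρ
  have hτ0 : 0 < τ := by linarith
  have hτ1 : τ ≤ r ^ 2 := by linarith
  have hρ0 : 0 < ρ := by
    have := pow_lt_pow_left₀ hpz (norm_nonneg _) two_ne_zero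
    linarith
  have hρ1 : ρ ≤ r ^ 2 := by have := sq_nonneg ‖p.1 - z‖; linarith
  have hψp : parabolicCutoff z t r p = ρ * τ := rfl
  have hline : ∀ a : EuclideanSpace ℝ (Fin n) × ℝ, ∀ᶠ s : ℝ in 𝓝 0, p + s • a ∈ O := by
    intro a
    have hc : ContinuousAt (fun s : ℝ => p + s • a) 0 := by fun_prop
    exact hc.eventually (by simpa using hO.mem_nhds hpO)
  have hder : ∀ {f : EuclideanSpace ℝ (Fin n) × ℝ → ℝ}, ContDiffOn ℝ (⊤ : ℕ∞) f O →
      ∀ a : EuclideanSpace ℝ (Fin n) × ℝ, ∀ᶠ s : ℝ in 𝓝 0,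
        HasDerivAt (fun s : ℝ => f (p + s • a)) (fderiv ℝ f (p + s • a) a) s := by
    intro f hf a
    filter_upwards [hline a] with s hs
    exact hasDerivAt_comp_line (hf.differentiableAt_of_isOpen hO hs)
  have hspace : ∀ i : Fin n,
      (-2 * (p.1 - z) i * τ) * v p + (ρ * τ) * fderiv ℝ v p (EuclideanSpace.single i 1, 0) =
        m * ((k - 1 - Real.log (U p)) * fderiv ℝ U p (EuclideanSpace.single i 1, 0)) ∧
      (-2 * τ) * v p
        + 2 * ((-2 * (p.1 - z) i * τ) * fderiv ℝ v p (EuclideanSpace.single i 1, 0))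
        + (ρ * τ) * fderiv ℝ (fun q => fderiv ℝ v q (EuclideanSpace.single i 1, 0)) p
            (EuclideanSpace.single i 1, 0)
        - m * ((k - 1 - Real.log (U p)) *
            fderiv ℝ (fun q => fderiv ℝ U q (EuclideanSpace.single i 1, 0)) p
              (EuclideanSpace.single i 1, 0)
          - fderiv ℝ U p (EuclideanSpace.single i 1, 0) ^ 2 / U p) ≤ 0 := by
    intro i
    set a : EuclideanSpace ℝ (Fin n) × ℝ := (EuclideanSpace.single i 1, 0) with ha
    have hψ1 : ∀ s : ℝ, HasDerivAt (fun s : ℝ => parabolicCutoff z t r (p + s • a))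
        (-2 * ((p.1 - z) i + s) * τ) s := by
      intro s
      simp only [ha, parabolicCutoff_add_space]
      have := (((((hasDerivAt_id s).const_mul 2).mul_const ((p.1 - z) i)).const_sub ρ).sub
        ((hasDerivAt_id s).pow 2)).mul_const τ
      refine this.congr_deriv ?_
      simp
      ring
    have hψ2 : HasDerivAt (fun s : ℝ => -2 * ((p.1 - z) i + s) * τ) (-2 * τ) 0 := by
      have := (((hasDerivAt_id (0 : ℝ)).const_add ((p.1 - z) i)).const_mul (-2)).mul_const τ
      exact this.congr_deriv (by simp)
    have hball : ∀ᶠ s : ℝ in 𝓝 0, p + s • a ∈ closedBall z r ×ˢ Icc (t - r ^ 2) t := by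
      have hc : ContinuousAt (fun s : ℝ => ‖(p + s • a).1 - z‖) 0 := by fun_prop
      filter_upwards [hc.eventually_lt_const (by simpa using hpz)] with s hs
      refine ⟨?_, ?_⟩
      · rw [mem_closedBall_iff_norm]; exact hs.le
      · simp only [ha, Prod.snd_add, Prod.smul_snd, smul_zero, add_zero]
        exact ⟨hpt.le, hpt'⟩
    have hlm : IsLocalMax (fun s : ℝ => parabolicCutoff z t r (p + s • a) * v (p + s • a)
        - m * (U (p + s • a) * (k - Real.log (U (p + s • a))))) 0 := by
      filter_upwards [hball] with s hs
      have h1 := hmax _ hs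
      simp only [zero_smul, add_zero]
      linarith
    have := comparison_conditions_of_isLocalMax (Eventually.of_forall hψ1) hψ2 (hder hv a)
      (hder (hv.fderiv_apply_const hO a) a).self_of_nhds (hder hU a)
      (hder (hU.fderiv_apply_const hO a) a).self_of_nhds
      ((hline a).mono fun s hs => hpos _ hs) hlm
    simpa only [zero_smul, add_zero, hψp] using this
  have htime : 0 ≤ ρ * v p + (ρ * τ) * fderiv ℝ v p (0, 1)
      - m * ((k - 1 - Real.log (U p)) * fderiv ℝ U p (0, 1)) := by
    set a : EuclideanSpace ℝ (Fin n) × ℝ := (0, 1) with ha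
    have hψ1 : HasDerivAt (fun s : ℝ => parabolicCutoff z t r (p + s • a)) ρ 0 := by
      simp only [ha, parabolicCutoff_add_time]
      have := (((hasDerivAt_id (0 : ℝ)).const_add p.2).sub_const (t - r ^ 2)).const_mul ρ
      exact this.congr_deriv (by simp)
    have hd := (hψ1.mul (hder hv a).self_of_nhds).sub
      (((hder hU a).self_of_nhds.mul_const_sub_log k (by simpa using hpos p hpO)).const_mul m)
    have hnn := hd.nonneg_of_eventually_le_left (by
      have h1 : ∀ᶠ s : ℝ in 𝓝[<] 0, -τ < s :=
        eventually_nhdsWithin_of_eventually_nhds (lt_mem_nhds (by linarith))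
      filter_upwards [h1, self_mem_nhdsWithin] with s hs1 (hs2 : s < 0)
      have h2 := hmax (p + s • a) ⟨by
        rw [mem_closedBall_iff_norm]; simpa [ha] using hpz.le, by
        simp only [ha, Prod.snd_add, Prod.smul_snd, smul_eq_mul, mul_one]
        constructor <;> linarith⟩
      simp only [Pi.mul_apply, Pi.sub_apply, zero_smul, add_zero]
      linarith)
    simpa only [zero_smul, add_zero, hψp] using hnn
  have hsum := Finset.sum_nonpos fun i (_ : i ∈ Finset.univ) => (hspace i).2
  rw [hheat p hpO, hvheat p hpO] at htime
  simp only [Finset.sum_sub_distrib, Finset.sum_add_distrib, ← Finset.mul_sum,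
    Finset.sum_const, Finset.card_univ, Fintype.card_fin, nsmul_eq_mul, ← Finset.sum_div] at hsum
  have hτr : τ ^ 2 ≤ r ^ 4 := by
    calc τ ^ 2 ≤ (r ^ 2) ^ 2 := by gcongr
      _ = r ^ 4 := by ring
  have hfin := sq_le_of_maximum_conditions (ι := Fin n) (ψ := ρ * τ) (v := v p) (m := m) (u := U p)
    (ℓ := k - Real.log (U p)) (D := ρ + 2 * n * τ) (A := (2 * n + 1) * r ^ 6) (B := 4 * r ^ 6)
    (C := ‖e‖ ^ 2) (dψ := fun i => -2 * (p.1 - z) i * τ)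
    (du := fun i => fderiv ℝ U p (EuclideanSpace.single i 1, 0))
    (dv := fun i => fderiv ℝ v p (EuclideanSpace.single i 1, 0))
    (by positivity) hm (hpos p hpO) (by linarith [hle p hpO]) (by positivity) (by positivity) heq
    (fun i => by
      have := (hspace i).1
      rw [this]; ring)
    (by linarith)
    (by
      calc ρ * τ * (ρ + 2 * n * τ) ≤ r ^ 2 * r ^ 2 * (r ^ 2 + 2 * n * r ^ 2) := by gcongr
        _ = _ := by ring)
    (by
      have h1 : ∑ i, (-2 * (p.1 - z) i * τ) ^ 2 = 4 * τ ^ 2 * ‖p.1 - z‖ ^ 2 := by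
        rw [EuclideanSpace.real_norm_sq_eq, Finset.mul_sum]
        exact Finset.sum_congr rfl fun i _ => by ring
      rw [h1]
      calc 4 * τ ^ 2 * ‖p.1 - z‖ ^ 2 ≤ 4 * r ^ 4 * r ^ 2 := by gcongr
        _ = _ := by ring)
    (fderiv_apply_sq_le e)
  refine hfin.trans_eq ?_
  ring

/-- Interior logarithmic gradient estimate for positive bounded solutions. -/
lemma fderiv_le_of_cylinder_subset {U : EuclideanSpace ℝ (Fin n) × ℝ → ℝ}
    {O : Set (EuclideanSpace ℝ (Fin n) × ℝ)} (hO : IsOpen O)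
    (hU : ContDiffOn ℝ (⊤ : ℕ∞) U O) (hheat : JointHeatOn U O) {k : ℝ}
    (hpos : ∀ p ∈ O, 0 < U p) (hle : ∀ p ∈ O, Real.log (U p) + 1 ≤ k)
    {z : EuclideanSpace ℝ (Fin n)} {t r : ℝ} (hr : 0 < r)
    (hsub : closedBall z r ×ˢ Icc (t - r ^ 2) t ⊆ O) (e : EuclideanSpace ℝ (Fin n)) :
    fderiv ℝ U (z, t) (e, 0) ≤
      √(2 * (2 * n + 17)) * (‖e‖ / r) * (U (z, t) * (k - Real.log (U (z, t)))) := by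
  have hG : ∀ q ∈ O, 0 < U q * (k - Real.log (U q)) := fun q hq =>
    mul_pos (hpos q hq) (by linarith [hle q hq])
  have hzt : (z, t) ∈ closedBall z r ×ˢ Icc (t - r ^ 2) t :=
    ⟨mem_closedBall_self hr.le, by constructor <;> nlinarith⟩
  have hcont : ContinuousOn (fun q => parabolicCutoff z t r q * fderiv ℝ U q (e, 0) /
      (U q * (k - Real.log (U q)))) (closedBall z r ×ˢ Icc (t - r ^ 2) t) := by
    have hUc := hU.continuousOn.mono hsub
    have hψc : Continuous (parabolicCutoff z t r) := by unfold parabolicCutoff; fun_prop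
    exact (hψc.continuousOn.mul ((hU.fderiv_apply_const hO (e, 0)).continuousOn.mono hsub)).div
      (hUc.mul (continuousOn_const.sub (hUc.log fun q hq => (hpos q (hsub hq)).ne')))
      fun q hq => (hG q (hsub hq)).ne'
  obtain ⟨p, hp, hpmax⟩ := ((isCompact_closedBall z r).prod isCompact_Icc).exists_isMaxOn
    ⟨_, hzt⟩ hcont
  set m := parabolicCutoff z t r p * fderiv ℝ U p (e, 0) / (U p * (k - Real.log (U p))) with hm
  have hmax : ∀ q ∈ closedBall z r ×ˢ Icc (t - r ^ 2) t,
      parabolicCutoff z t r q * fderiv ℝ U q (e, 0) ≤ m * (U q * (k - Real.log (U q))) := by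
    intro q hq
    exact (div_le_iff₀ (hG q (hsub hq))).1 (hpmax hq)
  have hmle : m ≤ √(2 * (2 * n + 17)) * (‖e‖ * r ^ 3) := by
    rcases le_or_gt m 0 with h0 | h0
    · exact h0.trans (by positivity)
    have hψ : parabolicCutoff z t r p ≠ 0 := by
      intro h; rw [hm, h] at h0; simp at h0
    have hp1 : ‖p.1 - z‖ ≤ r := mem_closedBall_iff_norm.1 hp.1
    have hsq := sq_le_of_cutoff_maximum hO hU hheat hpos hle e (hsub hp) h0
      (lt_of_le_of_ne hp1 fun h => hψ (by simp [parabolicCutoff, h]))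
      (lt_of_le_of_ne hp.2.1 fun h => hψ (by simp [parabolicCutoff, ← h]))
      hp.2.2 ((div_eq_iff (hG p (hsub hp)).ne').1 hm.symm) hmax
    refine le_of_sq_le_sq ?_ (by positivity)
    rw [mul_pow, Real.sq_sqrt (by positivity)]
    refine hsq.trans_eq (by ring)
  have hc := hmax _ hzt
  have hψz : parabolicCutoff z t r (z, t) = r ^ 4 := by simp [parabolicCutoff]; ring
  rw [hψz] at hc
  have hGz := hG _ (hsub hzt)
  have hr4 : 0 < r ^ 4 := by positivity
  refine le_of_mul_le_mul_left ?_ hr4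
  calc r ^ 4 * fderiv ℝ U (z, t) (e, 0) ≤ m * (U (z, t) * (k - Real.log (U (z, t)))) := hc
    _ ≤ √(2 * (2 * n + 17)) * (‖e‖ * r ^ 3) * (U (z, t) * (k - Real.log (U (z, t)))) := by gcongr
    _ = _ := by field_simp

/-- Harnack inequality at an interior time, in logarithmic form. -/
lemma log_harnack_of_interior {U : EuclideanSpace ℝ (Fin n) × ℝ → ℝ}
    {O : Set (EuclideanSpace ℝ (Fin n) × ℝ)} (hO : IsOpen O)
    (hU : ContDiffOn ℝ (⊤ : ℕ∞) U O) (hheat : JointHeatOn U O) {k : ℝ}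
    (hpos : ∀ p ∈ O, 0 < U p) (hle : ∀ p ∈ O, Real.log (U p) + 1 ≤ k)
    {x y : EuclideanSpace ℝ (Fin n)} {t r : ℝ} (hr : 0 < r) (hxy : dist x y ≤ 4 * r)
    (hsub : ∀ z ∈ segment ℝ y x, closedBall z r ×ˢ Icc (t - r ^ 2) t ⊆ O) :
    k - Real.log (U (x, t)) ≤
      Real.exp (4 * √(2 * (2 * n + 17))) * (k - Real.log (U (y, t))) := by
  have hmem : ∀ s ∈ Icc (0 : ℝ) 1, y + s • (x - y) ∈ segment ℝ y x := by
    intro s hs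
    rw [segment_eq_image']
    exact ⟨s, hs, rfl⟩
  have hself : ∀ z ∈ segment ℝ y x, (z, t) ∈ O := fun z hz =>
    hsub z hz ⟨mem_closedBall_self hr.le, by constructor <;> nlinarith⟩
  have hder : ∀ s ∈ Icc (0 : ℝ) 1, HasDerivAt
      (fun s : ℝ => Real.log (k - Real.log (U (y + s • (x - y), t))))
      (-(fderiv ℝ U (y + s • (x - y), t) (x - y, 0) / U (y + s • (x - y), t)) /
        (k - Real.log (U (y + s • (x - y), t)))) s := by
    intro s hs
    have hO' := hself _ (hmem s hs)
    have hl : (y, t) + s • ((x - y, 0) : EuclideanSpace ℝ (Fin n) × ℝ) =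
        (y + s • (x - y), t) := by simp
    have h1 := hasDerivAt_comp_line (f := U) (p := (y, t)) (a := (x - y, 0)) (l := s)
      (by rw [hl]; exact hU.differentiableAt_of_isOpen hO hO')
    simp only [Prod.smul_mk, smul_zero, Prod.mk_add_mk, add_zero] at h1
    exact ((h1.log (hpos _ hO').ne').const_sub k).log (by linarith [hle _ hO'])
  have hbound : ∀ s ∈ Icc (0 : ℝ) 1,
      -(fderiv ℝ U (y + s • (x - y), t) (x - y, 0) / U (y + s • (x - y), t)) /
        (k - Real.log (U (y + s • (x - y), t))) ≤ 4 * √(2 * (2 * n + 17)) := by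
    intro s hs
    have hO' := hself _ (hmem s hs)
    have hp := hpos _ hO'
    have hl : 0 < k - Real.log (U (y + s • (x - y), t)) := by linarith [hle _ hO']
    have h1 := fderiv_le_of_cylinder_subset hO hU hheat hpos hle hr (hsub _ (hmem s hs)) (y - x)
    have h2 : fderiv ℝ U (y + s • (x - y), t) (y - x, 0) =
        -fderiv ℝ U (y + s • (x - y), t) (x - y, 0) := by
      rw [← map_neg]; simp
    have h3 : ‖y - x‖ / r ≤ 4 := by
      rw [div_le_iff₀ hr, ← dist_eq_norm, dist_comm]; exact hxy
    rw [← neg_div, ← h2, div_div, div_le_iff₀ (mul_pos hp hl)]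
    refine h1.trans ?_
    rw [mul_comm 4]
    gcongr
  have hmvt := (convex_Icc (0 : ℝ) 1).image_sub_le_mul_sub_of_deriv_le
    (f := fun s : ℝ => Real.log (k - Real.log (U (y + s • (x - y), t))))
    (fun s hs => (hder s hs).continuousAt.continuousWithinAt)
    (fun s hs => (hder s (interior_subset hs)).differentiableAt.differentiableWithinAt)
    (C := 4 * √(2 * (2 * n + 17)))
    (fun s hs => by
      rw [(hder s (interior_subset hs)).deriv]
      exact hbound s (interior_subset hs))
    0 (by simp) 1 (by simp) zero_le_one
  simp only [one_smul, zero_smul, add_zero, add_sub_cancel, sub_zero, mul_one] at hmvt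
  have hlx : 0 < k - Real.log (U (x, t)) := by linarith [hle _ (hself x (right_mem_segment ℝ y x))]
  have hly : 0 < k - Real.log (U (y, t)) := by linarith [hle _ (hself y (left_mem_segment ℝ y x))]
  rw [← Real.log_le_log_iff hlx (by positivity), Real.log_mul (Real.exp_pos _).ne' hly.ne',
    Real.log_exp]
  linarith

lemma rpow_le_of_one_add_log_le {a b K : ℝ} (ha : 0 < a) (hb : 0 < b)
    (h : 1 + Real.log a ≤ Real.exp K * (1 + Real.log b)) :
    Real.exp (Real.exp (-K) - 1) * a ^ Real.exp (-K) ≤ b := by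
  have h1 := mul_le_mul_of_nonneg_left h (Real.exp_pos (-K)).le
  rw [← mul_assoc, ← Real.exp_add, neg_add_cancel, Real.exp_zero] at h1
  rw [Real.rpow_def_of_pos ha, ← Real.exp_add, ← Real.le_log_iff_exp_le hb]
  linarith

end Heat

/-- Euclidean case of the elliptic-type Harnack inequality of Remark 2.1. -/
theorem elliptic_type_harnack (n : ℕ) (hn : 1 ≤ n) :
    ∃ θ : ℝ, θ ∈ Ioo (0:ℝ) 1 ∧ ∃ c : ℝ, 0 < c ∧
      ∀ (x₀ : EuclideanSpace ℝ (Fin n)) (t₀ R T M : ℝ), 0 < R → 0 < T → 0 < M →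
      ∀ u : EuclideanSpace ℝ (Fin n) → ℝ → ℝ,
        IsHeatSolutionOn u (closedBall x₀ R ×ˢ Icc (t₀ - T) t₀) →
        (∀ p ∈ closedBall x₀ R ×ˢ Icc (t₀ - T) t₀, 0 < u p.1 p.2 ∧ u p.1 p.2 ≤ M) →
        ∀ x ∈ closedBall x₀ (R / 2), ∀ y ∈ closedBall x₀ (R / 2),
          dist x y ≤ min (Real.sqrt T) R →
          ∀ t ∈ Icc (t₀ - T / 2) t₀,
            c * (M / u x t) ^ θ ≤ M / u y t := by
  set K : ℝ := 4 * √(2 * (2 * n + 17)) with hK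
  have hK0 : 0 < K := by positivity
  refine ⟨Real.exp (-K), ⟨Real.exp_pos _, Real.exp_lt_one_iff.2 (by linarith)⟩,
    Real.exp (Real.exp (-K) - 1), Real.exp_pos _, ?_⟩
  intro x₀ t₀ R T M hR hT hM u hu hbd x hx y hy hxy t ht
  have hsubQ : ball x₀ R ×ˢ Ioo (t₀ - T) t₀ ⊆ closedBall x₀ R ×ˢ Icc (t₀ - T) t₀ :=
    prod_mono ball_subset_closedBall Ioo_subset_Icc_self
  have hO : IsOpen (ball x₀ R ×ˢ Ioo (t₀ - T) t₀) := isOpen_ball.prod isOpen_Ioo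
  have hU := hu.1.mono hsubQ
  have hheat := jointHeatOn_of_deriv_eq_slap hO hU fun p hp => hu.2 p (hsubQ hp)
  have hle : ∀ p ∈ ball x₀ R ×ˢ Ioo (t₀ - T) t₀,
      Real.log (u p.1 p.2) + 1 ≤ 1 + Real.log M := fun p hp => by
    have := Real.log_le_log (hbd p (hsubQ hp)).1 (hbd p (hsubQ hp)).2
    linarith
  set ρ := min √T R with hρ
  have hρ0 : 0 < ρ := lt_min (Real.sqrt_pos.2 hT) hR
  have hρR : ρ ≤ R := min_le_right _ _
  have hρT : ρ ^ 2 ≤ T := by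
    calc ρ ^ 2 ≤ √T ^ 2 := by gcongr; exact min_le_left _ _
      _ = T := Real.sq_sqrt hT.le
  have hball : closedBall x₀ (R / 2) ⊆ closedBall x₀ R := closedBall_subset_closedBall (by linarith)
  have hinterior : ∀ s ∈ Ico (t₀ - T / 2) t₀,
      Real.exp (Real.exp (-K) - 1) * (M / u x s) ^ Real.exp (-K) ≤ M / u y s := by
    intro s hs
    have hs' : s ∈ Icc (t₀ - T) t₀ := ⟨by linarith [hs.1], hs.2.le⟩
    have hux := (hbd (x, s) ⟨hball hx, hs'⟩).1
    have huy := (hbd (y, s) ⟨hball hy, hs'⟩).1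
    have h := log_harnack_of_interior hO hU hheat (fun p hp => (hbd p (hsubQ hp)).1) hle
      (x := x) (y := y) (t := s) (r := ρ / 4) (by positivity) (by linarith) (by
        rintro z hz ⟨w, σ⟩ ⟨hw, hσ⟩
        have hz' : z ∈ closedBall x₀ (R / 2) :=
          (convex_closedBall x₀ (R / 2)).segment_subset hy hx hz
        have hw' : dist w z ≤ ρ / 4 := hw
        have hz'' : dist z x₀ ≤ R / 2 := hz'
        have hσ1 : s - (ρ / 4) ^ 2 ≤ σ := hσ.1
        have hσ2 : σ ≤ s := hσ.2
        refine ⟨?_, ?_, ?_⟩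
        · rw [mem_ball]
          linarith [dist_triangle w z x₀]
        · simp only
          nlinarith [hs.1]
        · exact hσ2.trans_lt hs.2)
    refine rpow_le_of_one_add_log_le (div_pos hM hux) (div_pos hM huy) ?_
    rw [Real.log_div hM.ne' hux.ne', Real.log_div hM.ne' huy.ne', ← add_sub_assoc, ← add_sub_assoc]
    exact h
  have hcont : ∀ z ∈ closedBall x₀ (R / 2), ContinuousWithinAt (fun s => M / u z s)
      (Ico (t₀ - T / 2) t₀) t := by
    intro z hz
    have hz' := hball hz
    have hmaps : MapsTo (fun s => (z, s)) (Icc (t₀ - T / 2) t₀)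
        (closedBall x₀ R ×ˢ Icc (t₀ - T) t₀) :=
      fun s hs => ⟨hz', by linarith [hs.1], hs.2⟩
    have hc : ContinuousOn (fun s => u z s) (Icc (t₀ - T / 2) t₀) :=
      hu.1.continuousOn.comp (by fun_prop) hmaps
    exact ((continuousOn_const.div hc fun s hs => (hbd _ (hmaps hs)).1.ne') t ht).mono
      Ico_subset_Icc_self
  refine ContinuousWithinAt.closure_le (s := Ico (t₀ - T / 2) t₀) ?_ ?_ (hcont y hy) hinterior
  · rw [closure_Ico (by linarith)]
    exact ht
  · exact ((hcont x hx).rpow_const (Or.inr (Real.exp_pos _).le)).const_mul _
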